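/- arXiv:1009.2270 — 9 statements merged into one kernel-verified Lean document; each statement's English description precedes it below -/
import Mathlib

section
/- Let I be a database and E a set of update actions such that E ∪ ne(I, I∘E) is consistent. Then for every E' ⊆ E, I∘E' = I∘(E' ∪ ne(I, I∘E)). -/
namespace AICF

/-- Propositional literals over atoms `At`. -/
inductive Lit (At : Type*) where
  | pos : At → Lit At
  | neg : At → Lit At

namespace Lit
variable {At : Type*}

/-- The dual literal. -/
def dual : Lit At → Lit At
  | pos a => neg a
  | neg a => pos a

/-- The underlying atom of a literal. -/
def atom : Lit At → At
  | pos a => a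
  | neg a => a

end Lit

variable {At : Type*}

/-- A database `I` entails a literal. -/
def entails (I : Set At) : Lit At → Prop
  | .pos a => a ∈ I
  | .neg a => a ∉ I

/-- A database entails a set of literals if it entails each member. -/
def entailsSet (I : Set At) (S : Set (Lit At)) : Prop := ∀ L ∈ S, entails I L

/-- Update actions: `+a` (insert) and `−a` (delete). -/
inductive UAct (At : Type*) where
  | add : At → UAct At
  | del : At → UAct At

namespace UAct
variable {At : Type*}

/-- The dual update action. -/
def dual : UAct At → UAct At
  | add a => del a
  | del a => add a

/-- The underlying atom of an update action. -/
def atom : UAct At → At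
  | add a => a
  | del a => a

/-- `lit(+a) = a`, `lit(−a) = not a`. -/
def lit : UAct At → Lit At
  | add a => .pos a
  | del a => .neg a

end UAct

/-- `ua(a) = +a`, `ua(not a) = −a`. -/
def Lit.ua : Lit At → UAct At
  | .pos a => .add a
  | .neg a => .del a

/-- A set of update actions is consistent if it contains no pair `+a, −a`. -/
def consistentActs (U : Set (UAct At)) : Prop :=
  ∀ a : At, ¬ (UAct.add a ∈ U ∧ UAct.del a ∈ U)

/-- `I ∘ U = (I ∪ {a : +a ∈ U}) \ {a : −a ∈ U}`. -/
def applyActs (I : Set At) (U : Set (UAct At)) : Set At :=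
  (I ∪ {a | UAct.add a ∈ U}) \ {a | UAct.del a ∈ U}

/-- The set of no-effect actions `ne(I,R)`. -/
def noEffect (I R : Set At) : Set (UAct At) :=
  UAct.add '' (I ∩ R) ∪ UAct.del '' (I ∪ R)ᶜ

/-- An active integrity constraint: body (literals), head (update actions),
with `lit(α)^D ∈ body` for each `α` in the head. -/
structure AIC (At : Type*) where
  body : Set (Lit At)
  head : Set (UAct At)
  hua : ∀ α ∈ head, (UAct.lit α).dual ∈ body

/-- `I ⊨ r` : `I` does not entail the whole body. -/
def satAIC (I : Set At) (r : AIC At) : Prop := ¬ entailsSet I r.body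

/-- `I ⊨ η`. -/
def satAICs (I : Set At) (η : Set (AIC At)) : Prop := ∀ r ∈ η, satAIC I r

/-- The updatable literals of `r`: `lit(head(r))^D`. -/
def AIC.up (r : AIC At) : Set (Lit At) := (fun α => (UAct.lit α).dual) '' r.head

/-- The non-updatable literals of `r`. -/
def AIC.nup (r : AIC At) : Set (Lit At) := r.body \ r.up

/-- `lit` of a set of update actions. -/
def litSet (U : Set (UAct At)) : Set (Lit At) := UAct.lit '' U

/-- `U` is closed under the aic `r`. -/
def closedUnder (U : Set (UAct At)) (r : AIC At) : Prop :=
  r.nup ⊆ litSet U → (r.head ∩ U).Nonempty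

/-- `U` is closed under the set `η` of aics. -/
def closedUnderSet (U : Set (UAct At)) (η : Set (AIC At)) : Prop :=
  ∀ r ∈ η, closedUnder U r

/-- `U` is a justified action set for `⟨I,η⟩`: `U` is consistent and is a minimal
set of update actions containing `ne(I, I∘U)` and closed under `η`. -/
def justifiedActionSet (I : Set At) (η : Set (AIC At)) (U : Set (UAct At)) : Prop :=
  consistentActs U ∧
  noEffect I (applyActs I U) ⊆ U ∧
  closedUnderSet U η ∧
  ∀ U' : Set (UAct At),
    noEffect I (applyActs I U) ⊆ U' → closedUnderSet U' η → U' ⊆ U → U' = U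

/-- `E` is a justified weak repair for `⟨I,η⟩`. -/
def justifiedWeakRepair (I : Set At) (η : Set (AIC At)) (E : Set (UAct At)) : Prop :=
  ∃ U : Set (UAct At), justifiedActionSet I η U ∧ E = U \ noEffect I (applyActs I U)

/-- `E` is a justified repair for `⟨I,η⟩`. -/
def justifiedRepair (I : Set At) (η : Set (AIC At)) (E : Set (UAct At)) : Prop :=
  justifiedWeakRepair I η E ∧ ∀ E' ⊆ E, satAICs (applyActs I E') η → E' = E

/-- `U` is a weak repair for `⟨I,η⟩`. -/
def weakRepair (I : Set At) (η : Set (AIC At)) (U : Set (UAct At)) : Prop :=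
  consistentActs U ∧
  (UAct.add '' I ∪ UAct.del '' Iᶜ) ∩ U = ∅ ∧
  satAICs (applyActs I U) η

/-- `U` is a repair for `⟨I,η⟩`. -/
def repair (I : Set At) (η : Set (AIC At)) (U : Set (UAct At)) : Prop :=
  weakRepair I η U ∧ ∀ U' ⊆ U, satAICs (applyActs I U') η → U' = U

/-- The update action `α` is founded w.r.t. `⟨I,η⟩` and `U`. -/
def foundedAct (I : Set At) (η : Set (AIC At)) (U : Set (UAct At)) (α : UAct At) : Prop :=
  ∃ r ∈ η, α ∈ r.head ∧ entailsSet (applyActs I U) r.nup ∧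
    ∀ β ∈ r.head \ {α}, entails (applyActs I U) (UAct.lit β).dual

/-- `U` is founded w.r.t. `⟨I,η⟩`. -/
def foundedSet (I : Set At) (η : Set (AIC At)) (U : Set (UAct At)) : Prop :=
  ∀ α ∈ U, foundedAct I η U α

/-- Founded weak repair. -/
def foundedWeakRepair (I : Set At) (η : Set (AIC At)) (U : Set (UAct At)) : Prop :=
  weakRepair I η U ∧ foundedSet I η U

/-- Founded repair. -/
def foundedRepair (I : Set At) (η : Set (AIC At)) (U : Set (UAct At)) : Prop :=
  repair I η U ∧ foundedSet I η U

/-- An aic is normal if its head has at most one update action. -/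
def AIC.normal (r : AIC At) : Prop := r.head.Subsingleton

/-- The normalization `η^n` of a set of aics. -/
def normSet (η : Set (AIC At)) : Set (AIC At) :=
  {s | ∃ r ∈ η, ∃ α ∈ r.head, s.body = r.body ∧ s.head = {α}}

/- ===== disjunctive logic programs ===== -/

/-- A disjunctive logic program rule `a₁|…|a_k ← β`. -/
structure DRule (At : Type*) where
  head : Set At
  body : Set (Lit At)

/-- A rule is simple: no atom occurs twice in it. -/
def DRule.simple (ρ : DRule At) : Prop :=
  (∀ a ∈ ρ.head, Lit.pos a ∉ ρ.body ∧ Lit.neg a ∉ ρ.body) ∧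
  ∀ a : At, ¬ (Lit.pos a ∈ ρ.body ∧ Lit.neg a ∈ ρ.body)

/-- `M'` is a model of the reduct `P^M`. -/
def modelOfReduct (P : Set (DRule At)) (M M' : Set At) : Prop :=
  ∀ ρ ∈ P, (∀ a : At, Lit.neg a ∈ ρ.body → a ∉ M) →
    {a | Lit.pos a ∈ ρ.body} ⊆ M' → (ρ.head ∩ M').Nonempty

/-- `M` is an answer set of `P`: a minimal model of the reduct `P^M`. -/
def answerSet (P : Set (DRule At)) (M : Set At) : Prop :=
  modelOfReduct P M M ∧ ∀ M' ⊆ M, modelOfReduct P M M' → M' = M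

/-- `aic(ρ) = not a₁,…,not a_k, β ⊃ +a₁|…|+a_k`. -/
def aicOfRule (ρ : DRule At) : AIC At :=
  ⟨Lit.neg '' ρ.head ∪ ρ.body, UAct.add '' ρ.head, by
    rintro α ⟨a, ha, rfl⟩
    exact Set.mem_union_left _ ⟨a, ha, rfl⟩⟩

def aicOfProg (P : Set (DRule At)) : Set (AIC At) := aicOfRule '' P

/- ===== revision programming ===== -/

/-- Revision literals `in(a)` and `out(a)`. -/
inductive RLit (At : Type*) where
  | inn : At → RLit At
  | out : At → RLit At

namespace RLit
variable {At : Type*}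
def dual : RLit At → RLit At
  | inn a => out a
  | out a => inn a
def toLit : RLit At → Lit At
  | inn a => .pos a
  | out a => .neg a
def ua : RLit At → UAct At
  | inn a => .add a
  | out a => .del a
end RLit

def consistentRLits (U : Set (RLit At)) : Prop :=
  ∀ a : At, ¬ (RLit.inn a ∈ U ∧ RLit.out a ∈ U)

/-- `I ⊕ U`. -/
def applyRLits (I : Set At) (U : Set (RLit At)) : Set At :=
  (I ∪ {a | RLit.inn a ∈ U}) \ {a | RLit.out a ∈ U}

/-- A database satisfies a revision literal. -/
def satR (I : Set At) : RLit At → Prop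
  | .inn a => a ∈ I
  | .out a => a ∉ I

/-- A revision rule `α₁|…|α_k ← β₁,…,β_m` with `k+m ≥ 1`. -/
structure RRule (At : Type*) where
  head : Set (RLit At)
  body : Set (RLit At)
  hne : (head ∪ body).Nonempty

/-- `I` satisfies a revision rule. -/
def satRRule (I : Set At) (r : RRule At) : Prop :=
  (∀ β ∈ r.body, satR I β) → ∃ α ∈ r.head, satR I α

def satRProg (I : Set At) (P : Set (RRule At)) : Prop := ∀ r ∈ P, satRRule I r

/-- The inertia set `I(I,R)`. -/
def inertia (I R : Set At) : Set (RLit At) :=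
  RLit.inn '' (I ∩ R) ∪ RLit.out '' (I ∪ R)ᶜ

/-- A revision literal viewed as a revision rule with singleton head and empty body. -/
def RLit.toRule (α : RLit At) : RRule At := ⟨{α}, ∅, by simp⟩

def weakRevision (P : Set (RRule At)) (I : Set At) (U : Set (RLit At)) : Prop :=
  consistentRLits U ∧ U ∩ inertia I (applyRLits I U) = ∅ ∧ satRProg (applyRLits I U) P

def revision (P : Set (RRule At)) (I : Set At) (U : Set (RLit At)) : Prop :=
  weakRevision P I U ∧ ∀ U' ⊆ U, satRProg (applyRLits I U') P → U' = U

/-- `U` is closed under a revision program. -/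
def closedRev (U : Set (RLit At)) (P : Set (RRule At)) : Prop :=
  ∀ r ∈ P, r.body ⊆ U → (r.head ∩ U).Nonempty

/-- `U` is a P-justified update for `I`: a consistent minimal set closed under
`P ∪ I(I, I⊕U)`. -/
def justifiedUpdate (P : Set (RRule At)) (I : Set At) (U : Set (RLit At)) : Prop :=
  consistentRLits U ∧
  closedRev U (P ∪ RLit.toRule '' inertia I (applyRLits I U)) ∧
  ∀ U' ⊆ U, closedRev U' (P ∪ RLit.toRule '' inertia I (applyRLits I U)) → U' = U

def justifiedWeakRevision (P : Set (RRule At)) (I : Set At) (E : Set (RLit At)) : Prop :=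
  ∃ U : Set (RLit At), justifiedUpdate P I U ∧ E = U \ inertia I (applyRLits I U)

def justifiedRevision (P : Set (RRule At)) (I : Set At) (E : Set (RLit At)) : Prop :=
  justifiedWeakRevision P I E ∧ ∀ E' ⊆ E, satRProg (applyRLits I E') P → E' = E

def foundedRLit (P : Set (RRule At)) (I : Set At) (E : Set (RLit At)) (α : RLit At) : Prop :=
  ∃ r ∈ P, α ∈ r.head ∧ (∀ β ∈ r.body, satR (applyRLits I E) β) ∧
    ∀ β ∈ r.head \ {α}, satR (applyRLits I E) β.dual

def foundedRevSet (P : Set (RRule At)) (I : Set At) (E : Set (RLit At)) : Prop :=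
  ∀ α ∈ E, foundedRLit P I E α

def foundedWeakRevision (P : Set (RRule At)) (I : Set At) (E : Set (RLit At)) : Prop :=
  weakRevision P I E ∧ foundedRevSet P I E

def foundedRevision (P : Set (RRule At)) (I : Set At) (E : Set (RLit At)) : Prop :=
  revision P I E ∧ foundedRevSet P I E

/-- A revision program is normal if every head has at most one literal. -/
def normalRProg (P : Set (RRule At)) : Prop := ∀ r ∈ P, r.head.Subsingleton

/-- `head(P_R)`: heads of the rules of `P` whose bodies are satisfied by `R`. -/
def headsOfFired (P : Set (RRule At)) (R : Set At) : Set (RLit At) :=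
  {α | ∃ r ∈ P, (∀ β ∈ r.body, satR R β) ∧ α ∈ r.head}

def supportedUpdate (P : Set (RRule At)) (I : Set At) (U : Set (RLit At)) : Prop :=
  consistentRLits U ∧ U = headsOfFired P (applyRLits I U)

def supportedRevision (P : Set (RRule At)) (I : Set At) (E : Set (RLit At)) : Prop :=
  ∃ U : Set (RLit At), supportedUpdate P I U ∧ E = U \ inertia I (applyRLits I U)

/-- A revision program is proper: no head literal is dual of a body literal. -/
def properRProg (P : Set (RRule At)) : Prop :=
  ∀ r ∈ P, ∀ α ∈ r.head, α.dual ∉ r.body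

/-- `AIC(r)` for a revision rule `r`. -/
def AICofRRule (r : RRule At) : AIC At :=
  ⟨RLit.toLit '' r.body ∪ (fun α => (RLit.toLit α).dual) '' r.head,
   RLit.ua '' r.head, by
    rintro α ⟨β, hβ, rfl⟩
    refine Set.mem_union_right _ ⟨β, hβ, ?_⟩
    cases β <;> rfl⟩

def AICofProg (P : Set (RRule At)) : Set (AIC At) := AICofRRule '' P

/-- `ua` extended to sets of revision literals. -/
def uaSet (E : Set (RLit At)) : Set (UAct At) := RLit.ua '' E

/- ===== shifting ===== -/

open Classical in
/-- `T_W` on update actions. -/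
noncomputable def TWu (W : Set At) (α : UAct At) : UAct At :=
  if α.atom ∈ W then α.dual else α

open Classical in
/-- `T_W` on literals. -/
noncomputable def TWl (W : Set At) (L : Lit At) : Lit At :=
  if L.atom ∈ W then L.dual else L

lemma TW_lit_dual (W : Set At) (α : UAct At) :
    (UAct.lit (TWu W α)).dual = TWl W ((UAct.lit α).dual) := by
  unfold TWu TWl
  by_cases h : α.atom ∈ W <;> cases α <;>
    simp_all [UAct.dual, UAct.lit, UAct.atom, Lit.dual, Lit.atom]

/-- `T_W` on active integrity constraints. -/
noncomputable def TWaic (W : Set At) (r : AIC At) : AIC At :=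
  ⟨TWl W '' r.body, TWu W '' r.head, by
    rintro α ⟨β, hβ, rfl⟩
    rw [TW_lit_dual]
    exact ⟨_, r.hua β hβ, rfl⟩⟩

/-- A database entails an update action: `+a` iff `a ∈ I`, `−a` iff `a ∉ I`. -/
def entailsU (I : Set At) : UAct At → Prop
  | .add a => a ∈ I
  | .del a => a ∉ I

theorem statement2 {At : Type*} [Fintype At] (I : Set At) (E : Set (UAct At))
    (h : consistentActs (E ∪ noEffect I (applyActs I E))) :
    ∀ E' ⊆ E, applyActs I E' = applyActs I (E' ∪ noEffect I (applyActs I E)) := by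
  intro E' hE
  ext a
  have h1 := h a
  have h2 := @hE (UAct.add a)
  have h3 := @hE (UAct.del a)
  simp only [applyActs, noEffect, Set.mem_union, Set.mem_image, Set.mem_inter_iff,
    Set.mem_compl_iff, Set.mem_diff, Set.mem_setOf_eq, UAct.add.injEq, UAct.del.injEq,
    reduceCtorEq, and_false, exists_false, or_false, false_or, exists_eq_right] at *
  tauto

end AICF
end

section
/- Let I be a database, η a set of active integrity constraints, and E a consistent set of update actions. Then E is a justified weak repair for ⟨I,η⟩ if and only if E ∩ ne(I, I∘E) = ∅ and E ∪ ne(I, I∘E) is a justified action set for ⟨I,η⟩. -/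
namespace AICF

variable {At : Type*}

lemma add_mem_noEffect {At : Type*} (I R : Set At) (a : At) :
    UAct.add a ∈ noEffect I R ↔ a ∈ I ∧ a ∈ R := by
  simp [noEffect]

lemma del_mem_noEffect {At : Type*} (I R : Set At) (a : At) :
    UAct.del a ∈ noEffect I R ↔ a ∉ I ∧ a ∉ R := by
  simp [noEffect]

lemma mem_applyActs {At : Type*} (I : Set At) (U : Set (UAct At)) (a : At) :
    a ∈ applyActs I U ↔ (a ∈ I ∨ UAct.add a ∈ U) ∧ UAct.del a ∉ U := Iff.rfl

lemma applyActs_union_noEffect {At : Type*} (I : Set At) (E : Set (UAct At)) :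
    applyActs I (E ∪ noEffect I (applyActs I E)) = applyActs I E := by
  ext a
  rw [mem_applyActs I (E ∪ _), Set.mem_union, Set.mem_union, add_mem_noEffect,
    del_mem_noEffect, mem_applyActs]
  tauto

lemma applyActs_diff_noEffect {At : Type*} (I : Set At) (U : Set (UAct At))
    (hU : consistentActs U) :
    applyActs I (U \ noEffect I (applyActs I U)) = applyActs I U := by
  ext a
  have h := hU a
  rw [mem_applyActs I (U \ _), Set.mem_diff, Set.mem_diff, add_mem_noEffect,
    del_mem_noEffect, mem_applyActs]
  tauto

theorem statement3 {At : Type*} [Fintype At] (I : Set At) (η : Set (AIC At))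
    (E : Set (UAct At)) (hE : consistentActs E) :
    justifiedWeakRepair I η E ↔
      E ∩ noEffect I (applyActs I E) = ∅ ∧
        justifiedActionSet I η (E ∪ noEffect I (applyActs I E)) := by
  constructor
  · rintro ⟨U, hU, rfl⟩
    rw [applyActs_diff_noEffect I U hU.1, Set.diff_union_of_subset hU.2.1]
    exact ⟨Set.diff_inter_self, hU⟩
  · rintro ⟨h1, h2⟩
    refine ⟨_, h2, ?_⟩
    rw [applyActs_union_noEffect, Set.union_diff_right]
    exact (Set.disjoint_iff_inter_eq_empty.mpr h1).sdiff_eq_left.symm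

end AICF
end

section
/- Let I be a database, η a set of active integrity constraints, and E a justified weak repair for ⟨I,η⟩. Then E is a founded weak repair for ⟨I,η⟩. -/
namespace AICF

variable {At : Type*}

theorem mem_iff_of_justified {At : Type*} {I : Set At} {U : Set (UAct At)}
    (hc : consistentActs U) (hn : noEffect I (applyActs I U) ⊆ U) (α : UAct At) :
    α ∈ U ↔ entails (applyActs I U) α.lit := by
  cases α with
  | add a =>
    have h1 : a ∈ I → a ∈ applyActs I U → UAct.add a ∈ U :=
      fun h h' => hn (Or.inl ⟨a, ⟨h, h'⟩, rfl⟩)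
    have := hc a
    simp only [UAct.lit, entails]
    constructor
    · intro h
      exact ⟨Or.inr h, fun h' => this ⟨h, h'⟩⟩
    · intro h
      rcases h.1 with h2 | h2
      · exact h1 h2 h
      · exact h2
  | del a =>
    simp only [UAct.lit, entails]
    constructor
    · intro h h'
      exact h'.2 h
    · intro h
      by_cases hI : a ∈ I
      · by_contra h2
        exact h ⟨Or.inl hI, h2⟩
      · exact hn (Or.inr ⟨a, fun h3 => h3.elim hI h, rfl⟩)

theorem entails_dual_iff {At : Type*} (R : Set At) (L : Lit At) :
    entails R L.dual ↔ ¬ entails R L := by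
  cases L <;> simp [Lit.dual, entails]

theorem apply_diff {At : Type*} {I : Set At} {U : Set (UAct At)} (hc : consistentActs U) :
    applyActs I (U \ noEffect I (applyActs I U)) = applyActs I U := by
  ext a
  simp only [applyActs, noEffect, Set.mem_sdiff, Set.mem_union, Set.mem_ofPred_eq, Set.mem_image,
    Set.mem_inter_iff, Set.mem_compl_iff, UAct.add.injEq, UAct.del.injEq, exists_eq_right,
    reduceCtorEq, and_false, exists_false, or_false, false_or]
  have := hc a
  tauto

theorem statement5 {At : Type*} [Fintype At] (I : Set At) (η : Set (AIC At))
    (E : Set (UAct At)) (hE : justifiedWeakRepair I η E) :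
    foundedWeakRepair I η E := by
  obtain ⟨U, ⟨hc, hn, hcl, hmin⟩, rfl⟩ := hE
  have hm := mem_iff_of_justified hc hn
  have sub : ∀ L, entails (applyActs I U) L → L ∈ litSet U := by
    intro L hL
    cases L with
    | pos a => exact ⟨UAct.add a, (hm _).2 hL, rfl⟩
    | neg a => exact ⟨UAct.del a, (hm _).2 hL, rfl⟩
  refine ⟨⟨fun a h => hc a ⟨h.1.1, h.2.1⟩, ?_, ?_⟩, ?_⟩
  · ext α
    simp only [Set.mem_inter_iff, Set.mem_empty_iff_false, iff_false]
    rintro ⟨⟨a, ha, rfl⟩ | ⟨a, ha, rfl⟩, hU, hne⟩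
    · exact hne (Or.inl ⟨a, ⟨ha, (hm _).1 hU⟩, rfl⟩)
    · exact hne (Or.inr ⟨a, fun h => h.elim ha ((hm _).1 hU), rfl⟩)
  · rw [apply_diff hc]
    intro r hr hb
    obtain ⟨α, hα, hαU⟩ := hcl r hr (fun L hL => sub L (hb L hL.1))
    exact (entails_dual_iff _ _).1 (hb _ (r.hua α hα)) ((hm α).1 hαU)
  · rintro α ⟨hαU, hαn⟩
    have hnc : ¬ closedUnderSet (U \ {α}) η := by
      intro h
      have := hmin (U \ {α}) (fun β hβ => ⟨hn hβ, fun h' => hαn (h' ▸ hβ)⟩) h Set.sdiff_subset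
      rw [← this] at hαU
      exact hαU.2 rfl
    simp only [closedUnderSet, closedUnder, not_forall] at hnc
    obtain ⟨r, hr, hnup, hne⟩ := hnc
    have hnupU : r.nup ⊆ litSet U := hnup.trans (Set.image_mono Set.sdiff_subset)
    have huniq : ∀ β ∈ r.head, β ∈ U → β = α := by
      intro β hβ hβU
      by_contra hba
      exact hne ⟨β, hβ, hβU, hba⟩
    obtain ⟨γ, hγ, hγU⟩ := hcl r hr hnupU
    refine ⟨r, hr, huniq γ hγ hγU ▸ hγ, ?_, ?_⟩
    · rw [apply_diff hc]
      intro L hL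
      obtain ⟨β, hβ, rfl⟩ := hnupU hL
      exact (hm β).1 hβ
    · rw [apply_diff hc]
      rintro β ⟨hβ, hβα⟩
      exact (entails_dual_iff _ _).2 fun h => hβα (huniq β hβ ((hm β).2 h))

end AICF
end

section
/- Let I be a database and η a set of active integrity constraints such that for each update action α ∈ ⋃_{r∈η} head(r), I entails lit(α^D). If E is a justified weak repair for ⟨I,η⟩, then E is a justified repair for ⟨I,η⟩. -/
namespace AICF

variable {At : Type*}

theorem statement7 {At : Type*} [Fintype At] (I : Set At) (η : Set (AIC At))
    (h : ∀ r ∈ η, ∀ α ∈ r.head, entails I (UAct.lit α.dual))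
    (E : Set (UAct At)) (hE : justifiedWeakRepair I η E) :
    justifiedRepair I η E := by
  refine ⟨hE, ?_⟩
  obtain ⟨U, ⟨hc, hne, hcl, hmin⟩, rfl⟩ := hE
  intro E' hE' hsat
  have hsub : E' ⊆ U := fun x hx => (hE' hx).1
  have key : E' ∪ noEffect I (applyActs I U) = U := by
    refine hmin _ Set.subset_union_right ?_ (Set.union_subset hsub hne)
    intro r hr hnup
    have h1 := hsat r hr
    unfold satAIC entailsSet at h1
    push Not at h1
    obtain ⟨L, hL, hnL⟩ := h1
    by_cases hup : L ∈ r.up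
    · obtain ⟨α, hα, rfl⟩ := hup
      have hI := h r hr α hα
      refine ⟨α, hα, Or.inl ?_⟩
      cases α with
      | add a =>
        simp only [UAct.lit, UAct.dual, Lit.dual, entails, applyActs] at hI hnL
        by_contra hn
        exact hnL (fun hh => hh.1.elim hI hn)
      | del a =>
        simp only [UAct.lit, UAct.dual, Lit.dual, entails, applyActs] at hI hnL
        by_contra hn
        exact hnL ⟨Or.inl hI, hn⟩
    · exfalso
      obtain ⟨β, hβ, rfl⟩ := hnup ⟨hL, hup⟩
      have hβU : β ∈ U := Set.union_subset hsub hne hβ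
      apply hnL
      cases β with
      | add a =>
        refine ⟨?_, fun hd => hc a ⟨hβU, hsub hd⟩⟩
        rcases hβ with hβ | ⟨b, hb, hab⟩ | ⟨b, hb, hab⟩
        · exact Or.inr hβ
        · cases hab
          exact Or.inl hb.1
        · cases hab
      | del a =>
        rintro ⟨h2, h3⟩
        rcases h2 with h2 | h2
        · rcases hβ with hβ | ⟨b, hb, hab⟩ | ⟨b, hb, hab⟩
          · exact h3 hβ
          · cases hab
          · cases hab
            exact hb (Or.inl h2)
        · exact hc a ⟨hsub h2, hβU⟩
  apply Set.Subset.antisymm hE'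
  rintro x ⟨hx, hxn⟩
  rw [← key] at hx
  exact hx.resolve_right hxn

end AICF
end

section
/- Let I be a database and η a set of normal active integrity constraints. If E is a justified weak repair for ⟨I,η⟩, then E is a justified repair for ⟨I,η⟩. -/
namespace AICF

variable {At : Type*}

theorem statement8 {At : Type*} [Fintype At] (I : Set At) (η : Set (AIC At))
    (h : ∀ r ∈ η, r.normal)
    (E : Set (UAct At)) (hE : justifiedWeakRepair I η E) :
    justifiedRepair I η E := by
  refine ⟨hE, ?_⟩
  obtain ⟨U, ⟨hc, hne, hcl, hmin⟩, rfl⟩ := hE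
  intro E' hE' hsat
  have hE'U : E' ⊆ U := fun x hx => (hE' hx).1
  have key : E' ∪ noEffect I (applyActs I U) = U := by
    apply hmin _ Set.subset_union_right _ (Set.union_subset hE'U hne)
    intro r hr hn
    have hsub : E' ∪ noEffect I (applyActs I U) ⊆ U := Set.union_subset hE'U hne
    obtain ⟨α, hα, hαU⟩ := hcl r hr (hn.trans (Set.image_mono hsub))
    refine ⟨α, hα, ?_⟩
    by_contra hcon
    apply hsat r hr
    intro L hL
    by_cases hup : L ∈ r.up
    · obtain ⟨β, hβ, rfl⟩ := hup
      obtain rfl := h r hr hβ hα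
      cases β with
      | add a =>
        have h1 : UAct.del a ∉ U := fun h' => hc a ⟨hαU, h'⟩
        simp only [noEffect, Set.mem_union, not_or] at hcon
        simp only [UAct.lit, Lit.dual, entails]
        intro h2
        rcases h2.1 with h3 | h3
        · exact hcon.2.1 ⟨a, ⟨h3, Or.inl h3, h1⟩, rfl⟩
        · exact hcon.1 h3
      | del a =>
        have h1 : UAct.add a ∉ U := fun h' => hc a ⟨h', hαU⟩
        simp only [noEffect, Set.mem_union, not_or] at hcon
        simp only [UAct.lit, Lit.dual, entails]
        refine ⟨Or.inl ?_, hcon.1⟩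
        by_contra h3
        refine hcon.2.2 ⟨a, ?_, rfl⟩
        rintro (h4 | h4)
        · exact h3 h4
        · rcases h4.1 with h5 | h5
          · exact h3 h5
          · exact h1 h5
    · obtain ⟨β, hβ, rfl⟩ := hn ⟨hL, hup⟩
      have hβU := hsub hβ
      cases β with
      | add a =>
        have h1 : UAct.del a ∉ E' := fun h' => hc a ⟨hβU, hE'U h'⟩
        refine ⟨?_, h1⟩
        rcases hβ with hβ | ⟨b, hb, hb'⟩ | ⟨b, hb, hb'⟩
        · exact Or.inr hβ
        · cases hb'
          exact Or.inl hb.1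
        · cases hb'
      | del a =>
        have h1 : UAct.add a ∉ E' := fun h' => hc a ⟨hE'U h', hβU⟩
        rintro ⟨h2, h3⟩
        rcases hβ with hβ | ⟨b, hb, hb'⟩ | ⟨b, hb, hb'⟩
        · exact h3 hβ
        · cases hb'
        · cases hb'
          rcases h2 with h2 | h2
          · exact hb (Or.inl h2)
          · exact h1 h2
  apply hE'.antisymm
  rintro x ⟨hx, hx'⟩
  rw [← key] at hx
  exact hx.resolve_right hx'

end AICF
end

section
/- Let P be a simple disjunctive logic program and M', M sets of atoms such that M' ⊆ M. Then M' is a model of the reduct P^M if and only if the set of update actions {+a : a ∈ M'} ∪ {−a : a ∉ M} is closed under aic(P). -/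
namespace AICF

variable {At : Type*}

theorem statement10 {At : Type*} [Fintype At] (P : Set (DRule At))
    (hP : ∀ ρ ∈ P, ρ.simple) (M' M : Set At) (hMM : M' ⊆ M) :
    modelOfReduct P M M' ↔
      closedUnderSet (UAct.add '' M' ∪ UAct.del '' Mᶜ) (aicOfProg P) := by
  have hlp : ∀ a, Lit.pos a ∈ litSet (UAct.add '' M' ∪ UAct.del '' Mᶜ) ↔ a ∈ M' := by
    intro a
    constructor
    · rintro ⟨u, ⟨b, hb, rfl⟩ | ⟨b, hb, rfl⟩, h⟩
      · simp only [UAct.lit, Lit.pos.injEq] at h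
        exact h ▸ hb
      · simp [UAct.lit] at h
    · intro h
      exact ⟨_, Or.inl ⟨a, h, rfl⟩, rfl⟩
  have hln : ∀ a, Lit.neg a ∈ litSet (UAct.add '' M' ∪ UAct.del '' Mᶜ) ↔ a ∉ M := by
    intro a
    constructor
    · rintro ⟨u, ⟨b, hb, rfl⟩ | ⟨b, hb, rfl⟩, h⟩
      · simp [UAct.lit] at h
      · simp only [UAct.lit, Lit.neg.injEq] at h
        exact h ▸ hb
    · intro h
      exact ⟨_, Or.inr ⟨a, h, rfl⟩, rfl⟩
  have hnup : ∀ ρ ∈ P, (aicOfRule ρ).nup = ρ.body := by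
    intro ρ hρ
    ext L
    constructor
    · rintro ⟨⟨a, ha, rfl⟩ | h, hn⟩
      · exact absurd ⟨_, ⟨a, ha, rfl⟩, rfl⟩ hn
      · exact h
    · intro h
      refine ⟨Or.inr h, ?_⟩
      rintro ⟨_, ⟨a, ha, rfl⟩, rfl⟩
      exact ((hP ρ hρ).1 a ha).2 h
  have hhead : ∀ ρ : DRule At, ((aicOfRule ρ).head ∩ (UAct.add '' M' ∪ UAct.del '' Mᶜ)).Nonempty
      ↔ (ρ.head ∩ M').Nonempty := by
    intro ρ
    constructor
    · rintro ⟨_, ⟨a, ha, rfl⟩, ⟨b, hb, h⟩ | ⟨b, hb, h⟩⟩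
      · simp only [UAct.add.injEq] at h
        exact ⟨a, ha, h ▸ hb⟩
      · simp at h
    · rintro ⟨a, ha, hb⟩
      exact ⟨_, ⟨a, ha, rfl⟩, Or.inl ⟨a, hb, rfl⟩⟩
  constructor
  · rintro h _ ⟨ρ, hρ, rfl⟩ hs
    rw [hnup ρ hρ] at hs
    exact (hhead ρ).2 (h ρ hρ (fun a ha => (hln a).1 (hs ha)) (fun a ha => (hlp a).1 (hs ha)))
  · intro h ρ hρ h1 h2
    refine (hhead ρ).1 (h _ ⟨ρ, hρ, rfl⟩ ?_)
    rw [hnup ρ hρ]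
    intro L hL
    cases L with
    | pos a => exact (hlp a).2 (h2 hL)
    | neg a => exact (hln a).2 (h1 a hL)

end AICF
end

section
/- Let P be a simple disjunctive logic program. A set M of atoms is an answer set of P if and only if ua(M) = {+a : a ∈ M} is a justified weak repair for ⟨∅, aic(P)⟩. -/
namespace AICF

variable {At : Type*}

/-- The candidate action set: insert `N`, and delete everything outside `M`. -/
def candActs (M N : Set At) : Set (UAct At) := UAct.add '' N ∪ UAct.del '' Mᶜ

lemma add_mem_candActs (M N : Set At) (a : At) : UAct.add a ∈ candActs M N ↔ a ∈ N := by
  simp [candActs]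

lemma del_mem_candActs (M N : Set At) (a : At) : UAct.del a ∈ candActs M N ↔ a ∉ M := by
  simp [candActs]

lemma pos_mem_litSet (U : Set (UAct At)) (a : At) : Lit.pos a ∈ litSet U ↔ UAct.add a ∈ U := by
  constructor
  · rintro ⟨α, hα, h⟩
    cases α <;> simp_all [UAct.lit]
  · intro h
    exact ⟨_, h, rfl⟩

lemma neg_mem_litSet (U : Set (UAct At)) (a : At) : Lit.neg a ∈ litSet U ↔ UAct.del a ∈ U := by
  constructor
  · rintro ⟨α, hα, h⟩
    cases α <;> simp_all [UAct.lit]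
  · intro h
    exact ⟨_, h, rfl⟩

lemma nup_aicOfRule (ρ : DRule At) (h : ρ.simple) : (aicOfRule ρ).nup = ρ.body := by
  ext L
  constructor
  · rintro ⟨h1 | h1, h2⟩
    · obtain ⟨a, ha, rfl⟩ := h1
      exact absurd ⟨UAct.add a, ⟨a, ha, rfl⟩, rfl⟩ h2
    · exact h1
  · intro hL
    refine ⟨Or.inr hL, ?_⟩
    rintro ⟨_, ⟨a, ha, rfl⟩, rfl⟩
    exact (h.1 a ha).2 hL

lemma closed_candActs (P : Set (DRule At)) (hP : ∀ ρ ∈ P, ρ.simple) (M N : Set At) :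
    closedUnderSet (candActs M N) (aicOfProg P) ↔ modelOfReduct P M N := by
  have hh : ∀ ρ : DRule At, ((aicOfRule ρ).head ∩ candActs M N).Nonempty ↔
      (ρ.head ∩ N).Nonempty := by
    intro ρ
    constructor
    · rintro ⟨_, ⟨a, ha, rfl⟩, h⟩
      exact ⟨a, ha, (add_mem_candActs M N a).1 h⟩
    · rintro ⟨a, ha, h⟩
      exact ⟨_, ⟨a, ha, rfl⟩, (add_mem_candActs M N a).2 h⟩
  constructor
  · intro h ρ hρ hn hp
    refine (hh ρ).1 (h _ ⟨ρ, hρ, rfl⟩ ?_)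
    rw [nup_aicOfRule ρ (hP ρ hρ)]
    rintro (a | a) hL
    · exact (pos_mem_litSet _ a).2 ((add_mem_candActs M N a).2 (hp hL))
    · exact (neg_mem_litSet _ a).2 ((del_mem_candActs M N a).2 (hn a hL))
  · rintro h _ ⟨ρ, hρ, rfl⟩ hs
    rw [nup_aicOfRule ρ (hP ρ hρ)] at hs
    refine (hh ρ).2 (h ρ hρ ?_ ?_)
    · intro a ha
      exact (del_mem_candActs M N a).1 ((neg_mem_litSet _ a).1 (hs ha))
    · intro a ha
      exact (add_mem_candActs M N a).1 ((pos_mem_litSet _ a).1 (hs ha))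

lemma apply_candActs (M : Set At) : applyActs ∅ (candActs M M) = M := by
  ext a
  simp [applyActs, add_mem_candActs, del_mem_candActs]

lemma noEffect_empty (M : Set At) : noEffect ∅ M = UAct.del '' Mᶜ := by
  simp [noEffect]

lemma justified_candActs (P : Set (DRule At)) (hP : ∀ ρ ∈ P, ρ.simple) (M : Set At) :
    justifiedActionSet ∅ (aicOfProg P) (candActs M M) ↔ answerSet P M := by
  unfold justifiedActionSet answerSet
  rw [apply_candActs, noEffect_empty, closed_candActs P hP]
  constructor
  · rintro ⟨-, -, h1, h2⟩
    refine ⟨h1, fun N hN hm => ?_⟩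
    have := h2 (candActs M N) Set.subset_union_right ((closed_candActs P hP M N).2 hm)
      (Set.union_subset_union_left _ (Set.image_mono hN))
    ext a
    rw [← add_mem_candActs M N, this, add_mem_candActs]
  · rintro ⟨h1, h2⟩
    refine ⟨?_, Set.subset_union_right, h1, ?_⟩
    · rintro a ⟨h, h'⟩
      exact (del_mem_candActs M M a).1 h' ((add_mem_candActs M M a).1 h)
    · intro U' hne hcl hsub
      have hU : U' = candActs M {a | UAct.add a ∈ U'} := by
        ext (a | a)
        · rw [add_mem_candActs]; rfl
        · rw [del_mem_candActs]
          exact ⟨fun h => (del_mem_candActs M M a).1 (hsub h), fun h => hne ⟨a, h, rfl⟩⟩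
      have hN := h2 {a | UAct.add a ∈ U'}
        (fun a ha => (add_mem_candActs M M a).1 (hsub ha))
        ((closed_candActs P hP M _).1 (hU ▸ hcl))
      rw [hU, hN]

theorem statement11 {At : Type*} [Fintype At] (P : Set (DRule At))
    (hP : ∀ ρ ∈ P, ρ.simple) (M : Set At) :
    answerSet P M ↔
      justifiedWeakRepair (∅ : Set At) (aicOfProg P) (UAct.add '' M) := by
  constructor
  · intro h
    refine ⟨candActs M M, (justified_candActs P hP M).2 h, ?_⟩
    rw [apply_candActs, noEffect_empty]
    ext (a | a)
    · simp [add_mem_candActs]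
    · simp [del_mem_candActs]
  · rintro ⟨U, hU, hE⟩
    have hR : applyActs ∅ U = M := by
      ext a
      have h1 : UAct.add a ∈ UAct.add '' M ↔ UAct.add a ∈ U := by
        rw [hE]; simp [noEffect]
      have h2 := hU.1 a
      simp only [UAct.add.injEq, Set.mem_image, exists_eq_right] at h1
      simp only [applyActs, Set.empty_union, Set.mem_diff, Set.mem_setOf_eq]
      tauto
    have hUe : U = candActs M M := by
      have hne := hU.2.1
      rw [hR, noEffect_empty] at hne hE
      rw [candActs, hE, Set.diff_union_of_subset hne]
    rw [hUe] at hU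
    exact (justified_candActs P hP M).1 hU

end AICF
end

section
/- Let P be a revision program and I a database. If a set E of revision literals is a P-justified weak revision of I, then it is a P-founded weak revision of I; and if E is a P-justified revision of I, then it is a P-founded revision of I. -/
namespace AICF

variable {At : Type*}

/-- A justified update consists exactly of the literals satisfied by the revised database. -/
lemma justified_mem_iff {P : Set (RRule At)} {I : Set At} {U : Set (RLit At)}
    (h : justifiedUpdate P I U) (α : RLit At) :
    α ∈ U ↔ satR (applyRLits I U) α := by
  obtain ⟨hc, hcl, -⟩ := h
  have hin : ∀ β ∈ inertia I (applyRLits I U), β ∈ U := by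
    intro β hβ
    obtain ⟨γ, hγ, hγU⟩ := hcl β.toRule (Or.inr ⟨β, hβ, rfl⟩) (by simp [RLit.toRule])
    have hEq : γ = β := hγ
    exact hEq ▸ hγU
  cases α with
  | inn a =>
    constructor
    · intro ha
      exact ⟨Or.inr ha, fun hb => hc a ⟨ha, hb⟩⟩
    · intro ha
      rcases ha.1 with hI | hU
      · exact hin _ (Or.inl ⟨a, ⟨hI, ha⟩, rfl⟩)
      · exact hU
  | out a =>
    constructor
    · intro ha hb
      exact hb.2 ha
    · intro ha
      by_contra hn
      have hI : a ∉ I := fun hI => ha ⟨Or.inl hI, hn⟩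
      exact hn (hin _ (Or.inr ⟨a, fun hx => hx.elim hI ha, rfl⟩))

/-- Removing the inertia set does not change the result of the update. -/
lemma justified_apply {P : Set (RRule At)} {I : Set At} {U : Set (RLit At)}
    (h : justifiedUpdate P I U) :
    applyRLits I (U \ inertia I (applyRLits I U)) = applyRLits I U := by
  have hm := justified_mem_iff h
  generalize hR : applyRLits I U = R at hm
  ext a
  have h1 := hm (.inn a)
  have h2 := hm (.out a)
  simp only [satR] at h1 h2
  simp only [applyRLits, inertia, Set.mem_sdiff, Set.mem_union, Set.mem_setOf_eq, h1, h2,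
    Set.mem_image, Set.mem_inter_iff, Set.mem_compl_iff, RLit.inn.injEq, RLit.out.injEq,
    exists_eq_right, reduceCtorEq, and_false, exists_false, or_false, false_or]
  tauto

lemma justified_founded {P : Set (RRule At)} {I : Set At} {E : Set (RLit At)}
    (h : justifiedWeakRevision P I E) : foundedWeakRevision P I E := by
  obtain ⟨U, hU, rfl⟩ := h
  have hm := justified_mem_iff hU
  have hap := justified_apply hU
  obtain ⟨hc, hcl, hmin⟩ := hU
  refine ⟨⟨fun a ha => hc a ⟨ha.1.1, ha.2.1⟩, ?_, ?_⟩, ?_⟩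
  · rw [hap]
    exact Set.sdiff_inter_self
  · rw [hap]
    intro r hr hb
    obtain ⟨α, hα, hαU⟩ := hcl r (Or.inl hr) (fun β hβ => (hm β).2 (hb β hβ))
    exact ⟨α, hα, (hm α).1 hαU⟩
  · rintro α ⟨hαU, hαI⟩
    unfold foundedRLit
    rw [hap]
    by_contra hno
    have hEq := hmin (U \ {α}) Set.sdiff_subset (by
      rintro r (hr | ⟨β, hβ, rfl⟩) hb
      · obtain ⟨γ, hγ, hγU⟩ := hcl r (Or.inl hr) (fun β hβ => (hb hβ).1)
        by_contra hne
        have key : ∀ β ∈ r.head, β ∈ U → β = α := by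
          intro β hβ hβU
          by_contra hn
          exact hne ⟨β, hβ, hβU, hn⟩
        refine hno ⟨r, hr, key γ hγ hγU ▸ hγ, fun β hβ => (hm β).1 (hb hβ).1, ?_⟩
        rintro β ⟨hβ, hβα⟩
        have hn : ¬ satR (applyRLits I U) β := fun hs => hβα (key β hβ ((hm β).2 hs))
        cases β with
        | inn a => exact hn
        | out a => exact not_not.1 hn
      · obtain ⟨γ, hγ, hγU⟩ := hcl β.toRule (Or.inr ⟨β, hβ, rfl⟩) (by simp [RLit.toRule])
        refine ⟨γ, hγ, hγU, ?_⟩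
        have hEq : γ = β := hγ
        rintro rfl
        exact hαI (hEq ▸ hβ))
    rw [← hEq] at hαU
    exact hαU.2 rfl

theorem statement14 {At : Type*} [Fintype At] (P : Set (RRule At)) (I : Set At)
    (E : Set (RLit At)) :
    (justifiedWeakRevision P I E → foundedWeakRevision P I E) ∧
    (justifiedRevision P I E → foundedRevision P I E) := by
  exact ⟨justified_founded, fun h =>
    ⟨⟨(justified_founded h.1).1, h.2⟩, (justified_founded h.1).2⟩⟩

end AICF
end

section
/- Let P be a proper revision program and I a database. A set E of revision literals is a weak revision (respectively: revision, P-justified weak revision, P-justified revision, P-founded weak revision, P-founded revision) of I with respect to P if and only if ua(E) is a weak repair (respectively: repair, justified weak repair, justified repair, founded weak repair, founded repair) for ⟨I, AIC(P)⟩. -/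
namespace AICF

variable {At : Type*}

/-! ### Helper lemmas -/

lemma mem_uaSet {E : Set (RLit At)} (α : RLit At) : α.ua ∈ uaSet E ↔ α ∈ E := by
  constructor
  · rintro ⟨β, hβ, h⟩
    cases α <;> cases β <;> simp_all [RLit.ua]
  · exact fun h => ⟨α, h, rfl⟩

lemma add_mem_uaSet {E : Set (RLit At)} (a : At) : UAct.add a ∈ uaSet E ↔ RLit.inn a ∈ E :=
  mem_uaSet (RLit.inn a)

lemma del_mem_uaSet {E : Set (RLit At)} (a : At) : UAct.del a ∈ uaSet E ↔ RLit.out a ∈ E :=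
  mem_uaSet (RLit.out a)

lemma ua_surj (u : UAct At) : ∃ α : RLit At, α.ua = u := by
  cases u with
  | add a => exact ⟨.inn a, rfl⟩
  | del a => exact ⟨.out a, rfl⟩

lemma uaSet_surj (V : Set (UAct At)) : ∃ W : Set (RLit At), uaSet W = V := by
  refine ⟨RLit.ua ⁻¹' V, ?_⟩
  ext u
  obtain ⟨α, rfl⟩ := ua_surj u
  rw [mem_uaSet]; rfl

lemma uaSet_subset {E F : Set (RLit At)} : uaSet E ⊆ uaSet F ↔ E ⊆ F := by
  constructor
  · intro h α hα
    exact (mem_uaSet α).1 (h ((mem_uaSet α).2 hα))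
  · exact fun h => Set.image_mono h

lemma uaSet_inj {E F : Set (RLit At)} : uaSet E = uaSet F ↔ E = F := by
  constructor
  · intro h
    exact Set.Subset.antisymm (uaSet_subset.1 h.subset) (uaSet_subset.1 h.symm.subset)
  · rintro rfl; rfl

lemma uaSet_diff (E F : Set (RLit At)) : uaSet (E \ F) = uaSet E \ uaSet F := by
  ext u
  obtain ⟨α, rfl⟩ := ua_surj u
  rw [Set.mem_diff, mem_uaSet, mem_uaSet, mem_uaSet, Set.mem_diff]

lemma forall_uaSet {p : Set (UAct At) → Prop} : (∀ V, p V) ↔ ∀ W, p (uaSet W) := by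
  constructor
  · exact fun h W => h _
  · intro h V
    obtain ⟨W, rfl⟩ := uaSet_surj V
    exact h W

lemma exists_uaSet {p : Set (UAct At) → Prop} : (∃ V, p V) ↔ ∃ W, p (uaSet W) := by
  constructor
  · rintro ⟨V, h⟩
    obtain ⟨W, rfl⟩ := uaSet_surj V
    exact ⟨W, h⟩
  · rintro ⟨W, h⟩
    exact ⟨_, h⟩

lemma cons_uaSet (E : Set (RLit At)) : consistentActs (uaSet E) ↔ consistentRLits E := by
  simp only [consistentActs, consistentRLits, add_mem_uaSet, del_mem_uaSet]

lemma apply_uaSet (I : Set At) (E : Set (RLit At)) :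
    applyActs I (uaSet E) = applyRLits I E := by
  simp only [applyActs, applyRLits, add_mem_uaSet, del_mem_uaSet]

lemma noEffect_eq (I R : Set At) : noEffect I R = uaSet (inertia I R) := by
  unfold noEffect uaSet inertia
  rw [Set.image_union, Set.image_image, Set.image_image]
  rfl

lemma entails_toLit (I : Set At) (α : RLit At) : entails I α.toLit ↔ satR I α := by
  cases α <;> rfl

lemma entails_toLit_dual (I : Set At) (α : RLit At) :
    entails I α.toLit.dual ↔ ¬ satR I α := by
  cases α <;> simp [RLit.toLit, Lit.dual, entails, satR]

lemma satR_dual (I : Set At) (α : RLit At) : satR I α.dual ↔ ¬ satR I α := by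
  cases α <;> simp [RLit.dual, satR]

lemma lit_ua (α : RLit At) : α.ua.lit = α.toLit := by
  cases α <;> rfl

lemma toLit_inj {α β : RLit At} (h : α.toLit = β.toLit) : α = β := by
  cases α <;> cases β <;> simp_all [RLit.toLit]

lemma toLit_dual (α : RLit At) : α.dual.toLit = α.toLit.dual := by
  cases α <;> rfl

lemma sat_AICofRRule (I : Set At) (r : RRule At) :
    satAIC I (AICofRRule r) ↔ satRRule I r := by
  unfold satAIC satRRule entailsSet AICofRRule
  constructor
  · intro h hb
    by_contra hc
    push Not at hc
    apply h
    rintro L (⟨β, hβ, rfl⟩ | ⟨β, hβ, rfl⟩)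
    · exact (entails_toLit I β).2 (hb β hβ)
    · exact (entails_toLit_dual I β).2 (hc β hβ)
  · intro h hL
    obtain ⟨α, hα, hs⟩ := h fun β hβ =>
      (entails_toLit I β).1 (hL _ (Or.inl ⟨β, hβ, rfl⟩))
    exact (entails_toLit_dual I α).1 (hL _ (Or.inr ⟨α, hα, rfl⟩)) hs

lemma sat_AICofProg (I : Set At) (P : Set (RRule At)) :
    satAICs I (AICofProg P) ↔ satRProg I P := by
  unfold satAICs satRProg AICofProg
  rw [Set.forall_mem_image]
  exact forall₂_congr fun r _ => sat_AICofRRule I r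

lemma nup_AICofRRule {r : RRule At} (hr : ∀ α ∈ r.head, α.dual ∉ r.body) :
    (AICofRRule r).nup = RLit.toLit '' r.body := by
  ext L
  constructor
  · rintro ⟨h | ⟨α, hα, rfl⟩, hn⟩
    · exact h
    · exact absurd ⟨α.ua, ⟨α, hα, rfl⟩, by simp only [lit_ua]⟩ hn
  · rintro ⟨β, hβ, rfl⟩
    refine ⟨Or.inl ⟨β, hβ, rfl⟩, ?_⟩
    rintro ⟨_, ⟨α, hα, rfl⟩, h⟩
    simp only [lit_ua, ← toLit_dual] at h
    exact hr α hα (toLit_inj h ▸ hβ)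

lemma closedUnder_AIC {r : RRule At} (hr : ∀ α ∈ r.head, α.dual ∉ r.body)
    (U : Set (RLit At)) :
    closedUnder (uaSet U) (AICofRRule r) ↔ (r.body ⊆ U → (r.head ∩ U).Nonempty) := by
  unfold closedUnder
  have h1 : (AICofRRule r).nup ⊆ litSet (uaSet U) ↔ r.body ⊆ U := by
    rw [nup_AICofRRule hr]
    constructor
    · intro h β hβ
      obtain ⟨_, ⟨γ, hγ, rfl⟩, e⟩ := h ⟨β, hβ, rfl⟩
      rw [lit_ua] at e
      exact toLit_inj e ▸ hγ
    · rintro h _ ⟨β, hβ, rfl⟩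
      exact ⟨β.ua, ⟨β, h hβ, rfl⟩, lit_ua β⟩
  have h2 : ((AICofRRule r).head ∩ uaSet U).Nonempty ↔ (r.head ∩ U).Nonempty := by
    constructor
    · rintro ⟨_, ⟨α, hα, rfl⟩, hU⟩
      exact ⟨α, hα, (mem_uaSet α).1 hU⟩
    · rintro ⟨α, hα, hU⟩
      exact ⟨α.ua, ⟨α, hα, rfl⟩, (mem_uaSet α).2 hU⟩
  rw [h1, h2]

lemma closedUnderSet_AIC {P : Set (RRule At)} (hP : properRProg P) (U : Set (RLit At)) :
    closedUnderSet (uaSet U) (AICofProg P) ↔ closedRev U P := by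
  unfold closedUnderSet closedRev AICofProg
  rw [Set.forall_mem_image]
  exact forall₂_congr fun r hr => closedUnder_AIC (hP r hr) U

lemma closedRev_union (U S : Set (RLit At)) (P : Set (RRule At)) :
    closedRev U (P ∪ RLit.toRule '' S) ↔ S ⊆ U ∧ closedRev U P := by
  constructor
  · intro h
    refine ⟨fun α hα => ?_, fun r hr => h r (Or.inl hr)⟩
    obtain ⟨β, hβ, hU⟩ := h α.toRule (Or.inr ⟨α, hα, rfl⟩) (Set.empty_subset _)
    obtain rfl : β = α := hβ
    exact hU
  · rintro ⟨h1, h2⟩ r (hr | ⟨α, hα, rfl⟩)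
    · exact h2 r hr
    · exact fun _ => ⟨α, rfl, h1 hα⟩

lemma justified_iff {P : Set (RRule At)} (hP : properRProg P) (I : Set At)
    (U : Set (RLit At)) :
    justifiedUpdate P I U ↔ justifiedActionSet I (AICofProg P) (uaSet U) := by
  unfold justifiedUpdate justifiedActionSet
  rw [forall_uaSet]
  simp only [cons_uaSet, apply_uaSet, noEffect_eq, uaSet_subset, uaSet_inj,
    closedUnderSet_AIC hP, closedRev_union]
  tauto

lemma founded_iff {P : Set (RRule At)} (hP : properRProg P) (I : Set At)
    (E : Set (RLit At)) :
    foundedRevSet P I E ↔ foundedSet I (AICofProg P) (uaSet E) := by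
  unfold foundedRevSet foundedSet
  have key : ∀ α : RLit At, foundedRLit P I E α ↔
      foundedAct I (AICofProg P) (uaSet E) α.ua := by
    intro α
    unfold foundedRLit foundedAct AICofProg
    rw [Set.exists_mem_image]
    refine exists_congr fun r => and_congr_right fun hr => ?_
    rw [nup_AICofRRule (hP r hr), apply_uaSet]
    refine and_congr (mem_uaSet (E := r.head) α).symm (and_congr ?_ ?_)
    · unfold entailsSet
      rw [Set.forall_mem_image]
      exact forall₂_congr fun β _ => (entails_toLit _ β).symm
    · have : (AICofRRule r).head \ {α.ua} = uaSet (r.head \ {α}) := by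
        rw [uaSet_diff]
        simp [AICofRRule, uaSet]
      rw [this, uaSet, Set.forall_mem_image]
      refine forall₂_congr fun β _ => ?_
      rw [satR_dual, lit_ua, entails_toLit_dual]
  rw [uaSet, Set.forall_mem_image]
  exact forall₂_congr fun α _ => key α

lemma weak_iff (P : Set (RRule At)) (I : Set At) (E : Set (RLit At)) :
    weakRevision P I E ↔ weakRepair I (AICofProg P) (uaSet E) := by
  unfold weakRevision weakRepair
  rw [cons_uaSet, apply_uaSet, sat_AICofProg]
  refine and_congr_right fun hc => and_congr_left fun _ => ?_
  simp only [Set.eq_empty_iff_forall_notMem]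
  constructor
  · rintro h u ⟨⟨a, ha, rfl⟩ | ⟨a, ha, rfl⟩, hu⟩
    · rw [add_mem_uaSet] at hu
      exact h (.inn a) ⟨hu, Or.inl ⟨a, ⟨ha, Or.inl ha, fun h' => hc a ⟨hu, h'⟩⟩, rfl⟩⟩
    · rw [del_mem_uaSet] at hu
      refine h (.out a) ⟨hu, Or.inr ⟨a, ?_, rfl⟩⟩
      rintro (h' | h')
      · exact ha h'
      · exact h'.2 hu
  · rintro h α ⟨hα, ⟨a, ha, rfl⟩ | ⟨a, ha, rfl⟩⟩
    · exact h (.add a) ⟨Or.inl ⟨a, ha.1, rfl⟩, (add_mem_uaSet a).2 hα⟩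
    · exact h (.del a) ⟨Or.inr ⟨a, fun h' => ha (Or.inl h'), rfl⟩, (del_mem_uaSet a).2 hα⟩

lemma min_iff (P : Set (RRule At)) (I : Set At) (E : Set (RLit At)) :
    (∀ U' ⊆ E, satRProg (applyRLits I U') P → U' = E) ↔
    (∀ U' ⊆ uaSet E, satAICs (applyActs I U') (AICofProg P) → U' = uaSet E) := by
  conv_rhs => rw [forall_uaSet]
  simp only [uaSet_subset, apply_uaSet, sat_AICofProg, uaSet_inj]

lemma justifiedWeak_iff {P : Set (RRule At)} (hP : properRProg P) (I : Set At)
    (E : Set (RLit At)) :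
    justifiedWeakRevision P I E ↔ justifiedWeakRepair I (AICofProg P) (uaSet E) := by
  unfold justifiedWeakRevision justifiedWeakRepair
  conv_rhs => rw [exists_uaSet]
  refine exists_congr fun U => and_congr (justified_iff hP I U) ?_
  rw [apply_uaSet, noEffect_eq, ← uaSet_diff, uaSet_inj]

theorem statement15 {At : Type*} [Fintype At] (P : Set (RRule At))
    (hP : properRProg P) (I : Set At) (E : Set (RLit At)) :
    (weakRevision P I E ↔ weakRepair I (AICofProg P) (uaSet E)) ∧
    (revision P I E ↔ repair I (AICofProg P) (uaSet E)) ∧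
    (justifiedWeakRevision P I E ↔ justifiedWeakRepair I (AICofProg P) (uaSet E)) ∧
    (justifiedRevision P I E ↔ justifiedRepair I (AICofProg P) (uaSet E)) ∧
    (foundedWeakRevision P I E ↔ foundedWeakRepair I (AICofProg P) (uaSet E)) ∧
    (foundedRevision P I E ↔ foundedRepair I (AICofProg P) (uaSet E)) := by
  have hw := weak_iff P I E
  have hm := min_iff P I E
  have hj := justifiedWeak_iff hP I E
  have hf := founded_iff hP I E
  have hr : revision P I E ↔ repair I (AICofProg P) (uaSet E) := and_congr hw hm
  exact ⟨hw, hr, hj, and_congr hj hm, and_congr hw hf, and_congr hr hf⟩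


end AICF
end
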